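/- arXiv:2403.01337 — 2 statements merged into one kernel-verified Lean document; each statement's English description precedes it below -/
import Mathlib

section
/- Let Γ_𝒯 be the A₂-tilde group of a finite projective plane (P, L) with bijection σ : P ≃ L and compatible triella 𝒯, and let δ : Γ_𝒯 → ℕ × ℕ be the shape function. (1) If w ∈ Γ_𝒯 and m, n ∈ ℕ × ℕ satisfy δ(w) = m + n, then there exists a unique pair (h, k) of elements of Γ_𝒯 with w = h·k, δ(h) = m and δ(k) = n. (2) If w, h, k ∈ Γ_𝒯 satisfy δ(w·h·k) = δ(w) + δ(h) + δ(k), then δ(w·h) = δ(w) + δ(h) and δ(h·k) = δ(h) + δ(k). -/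
/-- The relations of the A₂-tilde group: `a_x a_y a_z = 1` for `(x, y, z) ∈ T`. -/
def A2Rels {P : Type} (T : Set (P × P × P)) : Set (FreeGroup P) :=
  (fun t : P × P × P => FreeGroup.of t.1 * FreeGroup.of t.2.1 * FreeGroup.of t.2.2) '' T

/-- The A₂-tilde group associated to a triella `T`. -/
abbrev A2TildeGroup {P : Type} (T : Set (P × P × P)) : Type := PresentedGroup (A2Rels T)

/-- The generator `a_x` of the A₂-tilde group. -/
def a {P : Type} (T : Set (P × P × P)) (x : P) : A2TildeGroup T := PresentedGroup.of x

/-- `(xs, ys)` is a right normal form of `w`: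
`w = a_{x₁} ⋯ a_{x_m} · a_{y₁}⁻¹ ⋯ a_{y_n}⁻¹` with `x_{i+1} ∉ σ x_i`, `y_j ∉ σ y_{j+1}`,
and `x_m ≠ y₁` when both lists are nonempty. -/
def IsRNF {P L : Type} [Membership P L] (σ : P ≃ L) (T : Set (P × P × P))
    (w : A2TildeGroup T) (xs ys : List P) : Prop :=
  w = (xs.map fun x => a T x).prod * (ys.map fun y => (a T y)⁻¹).prod ∧
  List.Chain' (fun p q => q ∉ σ p) xs ∧
  List.Chain' (fun p q => p ∉ σ q) ys ∧
  (∀ x ∈ xs.getLast?, ∀ y ∈ ys.head?, x ≠ y)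

/-- `(ts, ss)` is a left normal form of `w`:
`w = a_{t₁}⁻¹ ⋯ a_{t_n}⁻¹ · a_{s₁} ⋯ a_{s_m}` with `s_{i+1} ∉ σ s_i`, `t_j ∉ σ t_{j+1}`,
and the last entry of `ts` distinct from the first entry of `ss` when both are
nonempty. -/
def IsLNF {P L : Type} [Membership P L] (σ : P ≃ L) (T : Set (P × P × P))
    (w : A2TildeGroup T) (ts ss : List P) : Prop :=
  w = (ts.map fun t => (a T t)⁻¹).prod * (ss.map fun s => a T s).prod ∧
  List.Chain' (fun p q => q ∉ σ p) ss ∧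
  List.Chain' (fun p q => p ∉ σ q) ts ∧
  (∀ t ∈ ts.getLast?, ∀ s ∈ ss.head?, t ≠ s)

/-- The evaluation of a letter: `(x, true)` is the generator `a_x` and `(x, false)` its
inverse. -/
def letterEval {P : Type} (T : Set (P × P × P)) (pb : P × Bool) : A2TildeGroup T :=
  if pb.2 then a T pb.1 else (a T pb.1)⁻¹

/-- Combinatorial data: incidence `I x y` (meaning `y ∈ σ x`), triangles `T`, letters `b`. -/
structure A2Base {P G : Type} [Group G] (b : P → G) (I : P → P → Prop)
    (T : P → P → P → Prop) : Prop where
  rel : ∀ x y z, T x y z → b x * b y * b z = 1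
  cyc : ∀ x y z, T x y z → T y z x
  uniq : ∀ x y z z', T x y z → T x y z' → z = z'
  inc : ∀ x y, I x y ↔ ∃ z, T x y z
  join : ∀ x x', x ≠ x' → ∃ z, I z x ∧ I z x'
  meet : ∀ x x', x ≠ x' → ∃ z, I x z ∧ I x' z
  eqq : ∀ x y u v, I x u → I x v → I y u → I y v → x = y ∨ u = v

namespace A2Base

variable {P G : Type} [Group G] {b : P → G} {I : P → P → Prop} {T : P → P → P → Prop}

theorem incT (H : A2Base b I T) {x y z : P} (h : T x y z) : I x y := (H.inc x y).2 ⟨z, h⟩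

theorem incT2 (H : A2Base b I T) {x y z : P} (h : T x y z) : I y z := H.incT (H.cyc _ _ _ h)

theorem incT3 (H : A2Base b I T) {x y z : P} (h : T x y z) : I z x :=
  H.incT (H.cyc _ _ _ (H.cyc _ _ _ h))

theorem swapNP (H : A2Base b I T) {e t p z q : P} (h1 : T e t p) (h2 : T e z q) :
    (b t)⁻¹ * b z = b p * (b q)⁻¹ := by
  have e1 := H.rel _ _ _ h1
  have e2 := H.rel _ _ _ h2
  rw [mul_assoc] at e1 e2
  have e3 : b t * b p = b z * b q := by
    rw [← inv_eq_of_mul_eq_one_right e1, ← inv_eq_of_mul_eq_one_right e2]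
  rw [inv_mul_eq_iff_eq_mul, ← mul_assoc, e3]
  group

theorem swapPN (H : A2Base b I T) {s j u t x : P} (h1 : T s j u) (h2 : T t j x) :
    b s * (b t)⁻¹ = (b u)⁻¹ * b x := by
  have e1 := H.rel _ _ _ (H.cyc _ _ _ (H.cyc _ _ _ h1))
  have e2 := H.rel _ _ _ (H.cyc _ _ _ (H.cyc _ _ _ h2))
  have e3 : b u * b s = b x * b t := by
    rw [eq_inv_of_mul_eq_one_left e1, eq_inv_of_mul_eq_one_left e2]
  rw [eq_inv_mul_iff_mul_eq, ← mul_assoc, e3]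
  group

/-- Positive letter moved to the left through a reduced negative word. -/
theorem phase1 (H : A2Base b I T) (x : P) : ∀ ys : List P,
    List.IsChain (fun p q => ¬ I q p) ys → (∀ y ∈ ys.getLast?, y ≠ x) →
    ∃ p qs, (ys.map fun y => (b y)⁻¹).prod * b x = b p * (qs.map fun y => (b y)⁻¹).prod ∧
      qs.length = ys.length ∧ List.IsChain (fun p q => ¬ I q p) qs ∧
      (ys = [] → p = x) ∧
      (∀ y ∈ ys.head?, ∀ q ∈ qs.head?, ∃ z v, p ≠ q ∧ T z y p ∧ T z v q) := by
  intro ys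
  induction ys with
  | nil => intro _ _; exact ⟨x, [], by simp⟩
  | cons y ys ih =>
    intro hc hl
    rw [List.isChain_cons] at hc
    obtain ⟨p, qs, e, hlen, hqc, hnil, hhead⟩ := ih hc.2 (by
      intro w hw
      apply hl
      cases ys with
      | nil => simp at hw
      | cons a l => simpa [List.getLast?_cons_cons] using hw)
    have hne : y ≠ p := by
      cases ys with
      | nil => rw [hnil rfl]; exact hl y (by simp)
      | cons y1 ys =>
        cases qs with
        | nil => simp at hlen
        | cons q1 qs =>
          obtain ⟨z, v, _, h1, _⟩ := hhead y1 (by simp) q1 (by simp)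
          have := hc.1 y1 (by simp)
          rintro rfl
          exact this (H.incT2 h1)
    obtain ⟨z, hz1, hz2⟩ := H.join _ _ hne
    obtain ⟨p', hp'⟩ := (H.inc _ _).1 hz1
    obtain ⟨q', hq'⟩ := (H.inc _ _).1 hz2
    refine ⟨p', q' :: qs, ?_, by simp [hlen], ?_, by simp, ?_⟩
    · rw [List.map_cons, List.prod_cons, mul_assoc, e, ← mul_assoc, H.swapNP hp' hq']
      simp [mul_assoc]
    · rw [List.isChain_cons]
      refine ⟨?_, hqc⟩
      intro q1 hq1 hI
      cases ys with
      | nil => simp at hlen; subst hlen; simp at hq1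
      | cons y1 ys =>
        obtain ⟨z1, v, h0, h1, h2⟩ := hhead y1 (by simp) q1 hq1
        rcases H.eqq p q1 q' z1 (H.incT2 hq') (H.incT3 h1) hI (H.incT3 h2) with h | h
        · exact h0 h
        · subst h
          have := H.uniq _ _ _ _ (H.cyc _ _ _ hq') (H.cyc _ _ _ (H.cyc _ _ _ h1))
          subst this
          exact hc.1 z (by simp) hz1
    · intro y0 hy0 q0 hq0
      simp at hy0 hq0
      subst hy0 hq0
      refine ⟨z, p, ?_, hp', hq'⟩
      rintro rfl
      have hyp := H.uniq _ _ _ _ (H.cyc _ _ _ (H.cyc _ _ _ hp')) (H.cyc _ _ _ (H.cyc _ _ _ hq'))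
      exact hne hyp

/-- Right normal forms. -/
def NF (b : P → G) (I : P → P → Prop) (w : G) (xs ys : List P) : Prop :=
  w = (xs.map fun x => b x).prod * (ys.map fun y => (b y)⁻¹).prod ∧
  List.IsChain (fun p q => ¬ I p q) xs ∧
  List.IsChain (fun p q => ¬ I q p) ys ∧
  (∀ x ∈ xs.getLast?, ∀ y ∈ ys.head?, x ≠ y)

theorem lemmaR (H : A2Base b I T) {w : G} {xs ys : List P} (h : NF b I w xs ys) (x : P)
    (hx : ∀ y ∈ ys.getLast?, y ≠ x) :
    ∃ xs' ys', NF b I (w * b x) xs' ys' ∧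
      ((xs'.length = xs.length + 1 ∧ ys'.length = ys.length) ∨
       (xs'.length + 1 = xs.length ∧ ys'.length = ys.length + 1)) := by
  obtain ⟨hw, hxs, hys, hxy⟩ := h
  obtain ⟨p, qs, e, hlen, hqc, hnil, hhead⟩ := H.phase1 x ys hys hx
  have hpq : ∀ q ∈ qs.head?, p ≠ q := by
    intro q hq
    cases ys with
    | nil => simp at hlen; subst hlen; simp at hq
    | cons y ys =>
      obtain ⟨_, _, h, _⟩ := hhead y (by simp) q hq
      exact h
  by_cases hch : ∀ l ∈ xs.getLast?, ¬ I l p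
  · refine ⟨xs ++ [p], qs, ⟨?_, ?_, hqc, ?_⟩, Or.inl ⟨by simp, hlen⟩⟩
    · rw [hw, mul_assoc, e]; simp [mul_assoc]
    · rw [List.isChain_append]
      refine ⟨hxs, by simp, ?_⟩
      intro l hl y hy
      simp at hy
      subst hy
      exact hch l hl
    · intro l hl
      simp at hl
      subst hl
      exact hpq
  · push Not at hch
    obtain ⟨l, hl, hI⟩ := hch
    obtain ⟨xs0, rfl⟩ : ∃ xs0, xs = xs0 ++ [l] := by
      rw [Option.mem_def, List.getLast?_eq_some_iff] at hl
      exact hl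
    obtain ⟨u, hu⟩ := (H.inc _ _).1 hI
    rw [List.isChain_append] at hxs
    refine ⟨xs0, u :: qs, ⟨?_, hxs.1, ?_, ?_⟩, Or.inr ⟨by simp, by simp [hlen]⟩⟩
    · rw [hw, mul_assoc, e]
      have := eq_inv_of_mul_eq_one_left (H.rel _ _ _ hu)
      simp [mul_assoc, ← this]
    · rw [List.isChain_cons]
      refine ⟨?_, hqc⟩
      intro q hq hIq
      cases ys with
      | nil => simp at hlen; subst hlen; simp at hq
      | cons y ys =>
        obtain ⟨z, v, h0, h1, h2⟩ := hhead y (by simp) q hq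
        rcases H.eqq p q u z (H.incT2 hu) (H.incT3 h1) hIq (H.incT3 h2) with h | h
        · exact h0 h
        · subst h
          exact hxy l (by simp) y (by simp)
            (H.uniq _ _ _ _ (H.cyc _ _ _ hu) (H.cyc _ _ _ (H.cyc _ _ _ h1)))
    · intro k hk y hy
      simp at hy
      subst hy
      rintro rfl
      exact hxs.2.2 k hk l (by simp) (H.incT3 hu)

end A2Base

/-- Axioms on a shape function, in a form not mentioning normal forms. -/
structure A2Ax {P G : Type} [Group G] (b : P → G) (I : P → P → Prop)
    (T : P → P → P → Prop) (δ : G → ℕ × ℕ) : Prop extends A2Base b I T where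
  one : δ 1 = 0
  zero : ∀ w, (δ w).1 = 0 → (δ w).2 = 0 → w = 1
  step : ∀ w x, ((δ (w * b x)).1 = (δ w).1 + 1 ∧ (δ (w * b x)).2 = (δ w).2) ∨
    ((δ (w * b x)).1 + 1 = (δ w).1 ∧ (δ (w * b x)).2 = (δ w).2 + 1) ∨
    ((δ (w * b x)).1 = (δ w).1 ∧ (δ (w * b x)).2 + 1 = (δ w).2)
  neg : ∀ w x x', (δ (w * b x)).1 = (δ w).1 → (δ (w * b x)).2 + 1 = (δ w).2 →
    (δ (w * b x')).1 = (δ w).1 → (δ (w * b x')).2 + 1 = (δ w).2 → x = x'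
  negpeel : ∀ w n, (δ w).2 = n + 1 → ∃ h y, w = h * (b y)⁻¹ ∧ (δ h).1 = (δ w).1 ∧ (δ h).2 = n
  base : ∀ w m, (δ w).1 = m + 1 → (δ w).2 = 0 → ∃ g x, w = g * b x ∧ (δ g).1 = m ∧ (δ g).2 = 0 ∧
    ∀ z, ¬ I x z → (δ (w * b z)).1 = m + 2

namespace A2Ax

variable {P G : Type} [Group G] {b : P → G} {I : P → P → Prop} {T : P → P → P → Prop}
  {δ : G → ℕ × ℕ}

theorem stepneg (H : A2Ax b I T δ) (w : G) (x : P) :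
    ((δ w).1 = (δ (w * (b x)⁻¹)).1 + 1 ∧ (δ w).2 = (δ (w * (b x)⁻¹)).2) ∨
    ((δ w).1 + 1 = (δ (w * (b x)⁻¹)).1 ∧ (δ w).2 = (δ (w * (b x)⁻¹)).2 + 1) ∨
    ((δ w).1 = (δ (w * (b x)⁻¹)).1 ∧ (δ w).2 + 1 = (δ (w * (b x)⁻¹)).2) := by
  simpa using H.step (w * (b x)⁻¹) x

theorem pospeel (H : A2Ax b I T δ) : ∀ (n : ℕ) (v : G) (m : ℕ), (δ v).1 = m + 1 → (δ v).2 = n →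
    ∃ g x, v = g * b x ∧ (δ g).1 = m ∧ (δ g).2 = n ∧
      ∀ z, ¬ I x z → (δ (v * b z)).1 = m → (δ (v * b z)).2 = n + 1 → False := by
  intro n
  induction n with
  | zero =>
    intro v m h1 h2
    obtain ⟨g, x, e, h3, h4, h5⟩ := H.base v m h1 h2
    refine ⟨g, x, e, h3, h4, fun z hz h6 _ => ?_⟩
    have := h5 z hz
    omega
  | succ n ih =>
    intro v m h1 h2
    obtain ⟨v', t, e, h3, h4⟩ := H.negpeel v n h2
    obtain ⟨g', s, e', h5, h6, h7⟩ := ih v' m (h3.trans h1) h4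
    have hst : s ≠ t := by
      rintro rfl
      have : v = g' := by rw [e, e']; group
      rw [this] at h1
      omega
    obtain ⟨j, hj1, hj2⟩ := H.meet _ _ hst
    obtain ⟨u, hu⟩ := (H.inc _ _).1 hj1
    obtain ⟨x, hx⟩ := (H.inc _ _).1 hj2
    have ev : v = g' * (b u)⁻¹ * b x := by
      rw [e, e', mul_assoc, H.swapPN hu hx, mul_assoc]
    have hg : (δ (g' * (b u)⁻¹)).1 = m ∧ (δ (g' * (b u)⁻¹)).2 = n + 1 := by
      have s1 := H.stepneg g' u
      have s2 := H.step (g' * (b u)⁻¹) x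
      rw [← ev] at s2
      omega
    refine ⟨_, x, ev, hg.1, hg.2, ?_⟩
    intro z hz k1 k2
    by_cases htz : t = z
    · subst htz
      have : v * b t = v' := by rw [e]; group
      rw [this] at k1
      omega
    · obtain ⟨f, hf1, hf2⟩ := H.join _ _ htz
      obtain ⟨p, hp⟩ := (H.inc _ _).1 hf1
      obtain ⟨q, hq⟩ := (H.inc _ _).1 hf2
      have ez : v * b z = v' * b p * (b q)⁻¹ := by
        rw [e, mul_assoc, H.swapNP hp hq, mul_assoc]
      have hsp : ¬ I s p := by
        intro hI
        rcases H.eqq s t p j hI hj1 (H.incT2 hp) hj2 with h | h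
        · exact hst h
        · subst h
          have := H.uniq _ _ _ _ hx (H.cyc _ _ _ hp)
          subst this
          exact hz hf2
      have s1 := H.step v' p
      have s2 := H.stepneg (v' * b p) q
      have s3 := h7 p hsp
      rw [ez] at k1 k2
      rcases s1 with s1 | s1 | s1
      · omega
      · exact s3 (by omega) (by omega)
      · omega

theorem negUniq (H : A2Ax b I T δ) {h h' : G} {y y' : P} (e : h * (b y)⁻¹ = h' * (b y')⁻¹)
    (e1 : (δ h).1 = (δ h').1) (e2 : (δ h).2 = (δ h').2)
    (k1 : (δ (h * (b y)⁻¹)).1 = (δ h).1) (k2 : (δ (h * (b y)⁻¹)).2 = (δ h).2 + 1) : y = y' := by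
  have f1 : h * (b y)⁻¹ * b y = h := by group
  have f2 : h * (b y)⁻¹ * b y' = h' := by rw [e]; group
  apply H.neg (h * (b y)⁻¹)
  · rw [f1]; omega
  · rw [f1]; omega
  · rw [f2]; omega
  · rw [f2]; omega

theorem posUniq (H : A2Ax b I T δ) {h h' : G} {x x' : P} (e : h * b x = h' * b x')
    (e1 : (δ h).1 = (δ h').1) (e2 : (δ h).2 = (δ h').2)
    (k1 : (δ (h * b x)).1 = (δ h).1 + 1) (k2 : (δ (h * b x)).2 = (δ h).2) : x = x' := by
  by_contra hne
  obtain ⟨y, hy1, hy2⟩ := H.meet _ _ hne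
  obtain ⟨z, hz⟩ := (H.inc _ _).1 hy1
  obtain ⟨z', hz'⟩ := (H.inc _ _).1 hy2
  have hzz : z ≠ z' := by
    rintro rfl
    exact hne (H.uniq _ _ _ _ (H.cyc _ _ _ hz) (H.cyc _ _ _ hz'))
  have r1 : h * b x * b y = h * (b z)⁻¹ := by
    rw [mul_assoc, eq_inv_of_mul_eq_one_left (H.rel _ _ _ hz)]
  have r2 : h * b x * b y = h' * (b z')⁻¹ := by
    rw [e, mul_assoc, eq_inv_of_mul_eq_one_left (H.rel _ _ _ hz')]
  have s1 := H.step (h * b x) y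
  have s2 := H.stepneg h z
  rw [← r1] at s2
  by_cases hc : (δ (h * b x * b y)).1 = (δ h).1 ∧ (δ (h * b x * b y)).2 = (δ h).2 + 1
  · apply hzz
    apply H.negUniq (r1.symm.trans r2) e1 e2
    · rw [← r1]; omega
    · rw [← r1]; omega
  · have f1 : h * b x * b y * b z = h := by rw [r1]; group
    have f2 : h * b x * b y * b z' = h' := by rw [r2]; group
    obtain ⟨g, s, eg, g1, g2, g3⟩ :=
      H.pospeel (δ (h * b x * b y)).2 (h * b x * b y) (δ h).1 (by omega) rfl
    have i1 : I s z := by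
      by_contra hI
      refine g3 z hI ?_ ?_
      · rw [f1]
      · rw [f1]; omega
    have i2 : I s z' := by
      by_contra hI
      refine g3 z' hI ?_ ?_
      · rw [f2]; omega
      · rw [f2]; omega
    rcases H.eqq s y z z' i1 i2 (H.incT2 hz) (H.incT2 hz') with h0 | h0
    · subst h0
      have := mul_right_cancel eg
      rw [this] at k1
      omega
    · exact hzz h0

/-- Subadditivity of the shape in the dominance order. -/
theorem subadd (H : A2Ax b I T δ) : ∀ (N : ℕ) (h w : G), (δ h).1 + (δ h).2 = N →
    2 * (δ (w * h)).1 + (δ (w * h)).2 ≤ 2 * (δ w).1 + (δ w).2 + (2 * (δ h).1 + (δ h).2) ∧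
    (δ (w * h)).1 + 2 * (δ (w * h)).2 ≤ (δ w).1 + 2 * (δ w).2 + ((δ h).1 + 2 * (δ h).2) := by
  intro N
  induction N with
  | zero =>
    intro h w hN
    have := H.zero h (by omega) (by omega)
    subst this
    rw [mul_one]
    omega
  | succ N ih =>
    intro h w hN
    rcases Nat.eq_zero_or_eq_succ_pred (δ h).2 with h0 | h0
    · obtain ⟨g, x, e, h1, h2, _⟩ := H.base h N (by omega) h0
      have s1 := ih g w (by omega)
      have s2 := H.step (w * g) x
      rw [mul_assoc, ← e] at s2
      omega
    · obtain ⟨g, x, e, h1, h2⟩ := H.negpeel h _ h0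
      have s1 := ih g w (by omega)
      have s2 := H.stepneg (w * g) x
      rw [mul_assoc, ← e] at s2
      omega

theorem part2 (H : A2Ax b I T δ) (w h k : G) (e : δ (w * h * k) = δ w + δ h + δ k) :
    δ (w * h) = δ w + δ h ∧ δ (h * k) = δ h + δ k := by
  have s1 := H.subadd _ h w rfl
  have s2 := H.subadd _ k h rfl
  have s3 := H.subadd _ k (w * h) rfl
  have s4 := H.subadd _ (h * k) w rfl
  rw [← mul_assoc] at s4
  simp only [Prod.ext_iff, Prod.fst_add, Prod.snd_add] at e ⊢
  omega

theorem exist (H : A2Ax b I T δ) : ∀ (N : ℕ) (w : G) (m n : ℕ × ℕ), n.1 + n.2 = N →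
    δ w = m + n → ∃ h k, w = h * k ∧ δ h = m ∧ δ k = n := by
  have h1 := H.one
  intro N
  induction N with
  | zero =>
    intro w m n hN e
    have hn : n = 0 := by ext <;> simp <;> omega
    subst hn
    exact ⟨w, 1, by simp, by simpa using e, h1⟩
  | succ N ih =>
    intro w m n hN e
    simp only [Prod.ext_iff, Prod.fst_add, Prod.snd_add] at e
    rcases Nat.eq_zero_or_eq_succ_pred n.2 with h0 | h0
    · obtain ⟨g, x, eg, g1, g2, _⟩ := H.pospeel _ w (m.1 + N) (by omega) rfl
      obtain ⟨h, k, ek, k1, k2⟩ := ih g m (N, n.2) (by simp; omega) (by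
        ext <;> simp <;> omega)
      refine ⟨h, k * b x, by rw [eg, ek, mul_assoc], k1, ?_⟩
      have s1 := H.step k x
      have s2 := H.subadd _ (k * b x) h rfl
      rw [← mul_assoc, ← ek, ← eg] at s2
      simp only [Prod.ext_iff] at k1 k2 ⊢
      omega
    · obtain ⟨g, x, eg, g1, g2⟩ := H.negpeel w (m.2 + n.2 - 1) (by omega)
      obtain ⟨h, k, ek, k1, k2⟩ := ih g m (n.1, n.2 - 1) (by simp; omega) (by
        ext <;> simp <;> omega)
      refine ⟨h, k * (b x)⁻¹, by rw [eg, ek, mul_assoc], k1, ?_⟩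
      have s1 := H.stepneg k x
      have s2 := H.subadd _ (k * (b x)⁻¹) h rfl
      rw [← mul_assoc, ← ek, ← eg] at s2
      simp only [Prod.ext_iff] at k1 k2 ⊢
      omega

theorem unique (H : A2Ax b I T δ) : ∀ (N : ℕ) (h k h' k' : G), (δ k).1 + (δ k).2 = N →
    h * k = h' * k' → δ (h * k) = δ h + δ k → δ h = δ h' → δ k = δ k' → h = h' ∧ k = k' := by
  intro N
  induction N with
  | zero =>
    intro h k h' k' hN e _ _ e2
    have f := H.zero k (by omega) (by omega)
    rw [e2] at hN
    have f' := H.zero k' (by omega) (by omega)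
    subst f f'
    simpa using e
  | succ N ih =>
    intro h k h' k' hN e e0 e1 e2
    simp only [Prod.ext_iff, Prod.fst_add, Prod.snd_add] at e0 e1 e2
    rcases Nat.eq_zero_or_eq_succ_pred (δ k).2 with h0 | h0
    · obtain ⟨g, x, eg, g1, g2, _⟩ := H.base k N (by omega) h0
      obtain ⟨g', x', eg', g1', g2', _⟩ := H.base k' N (by omega) (by omega)
      have s0 := H.subadd _ g h rfl
      have s1 := H.step (h * g) x
      have s0' := H.subadd _ g' h' rfl
      have s1' := H.step (h' * g') x'
      have E : h * g * b x = h' * g' * b x' := by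
        rw [mul_assoc, mul_assoc, ← eg, ← eg', e]
      rw [← E] at s1'
      have E2 : h * k = h * g * b x := by rw [eg, mul_assoc]
      rw [E2] at e0
      have hx := H.posUniq E (by omega) (by omega) (by omega) (by omega)
      subst hx
      obtain ⟨r1, r2⟩ := ih h g h' g' (by omega) (mul_right_cancel E)
        (by simp only [Prod.ext_iff, Prod.fst_add, Prod.snd_add]; omega)
        (by simp only [Prod.ext_iff]; omega) (by simp only [Prod.ext_iff]; omega)
      exact ⟨r1, by rw [eg, eg', r2]⟩
    · obtain ⟨g, x, eg, g1, g2⟩ := H.negpeel k _ h0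
      obtain ⟨g', x', eg', g1', g2'⟩ := H.negpeel k' _ (e2.2.symm.trans h0)
      have s0 := H.subadd _ g h rfl
      have s1 := H.stepneg (h * g) x
      have s0' := H.subadd _ g' h' rfl
      have s1' := H.stepneg (h' * g') x'
      have E : h * g * (b x)⁻¹ = h' * g' * (b x')⁻¹ := by
        rw [mul_assoc, mul_assoc, ← eg, ← eg', e]
      rw [← E] at s1'
      have E2 : h * k = h * g * (b x)⁻¹ := by rw [eg, mul_assoc]
      rw [E2] at e0
      have hx := H.negUniq E (by omega) (by omega) (by omega) (by omega)
      subst hx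
      obtain ⟨r1, r2⟩ := ih h g h' g' (by omega) (mul_right_cancel E)
        (by simp only [Prod.ext_iff, Prod.fst_add, Prod.snd_add]; omega)
        (by simp only [Prod.ext_iff]; omega) (by simp only [Prod.ext_iff]; omega)
      exact ⟨r1, by rw [eg, eg', r2]⟩

end A2Ax

/-- unique factorisation with respect to the shape function `δ` of an
A₂-tilde group: (1) if `δ w = m + n` then `w` factors uniquely as `w = h·k` with
`δ h = m` and `δ k = n`; (2) if `δ (w·h·k) = δ w + δ h + δ k` then
`δ (w·h) = δ w + δ h` and `δ (h·k) = δ h + δ k`. -/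
theorem a2_shape_unique_factorisation (P L : Type) [Fintype P] [Fintype L]
    [Membership P L] [Configuration.ProjectivePlane P L]
    (σ : P ≃ L) (T : Set (P × P × P))
    (hT1 : ∀ x y : P, (∃ z, (x, y, z) ∈ T) ↔ y ∈ σ x)
    (hT2 : ∀ x y z : P, (x, y, z) ∈ T → (y, z, x) ∈ T)
    (hT3 : ∀ x y z z' : P, (x, y, z) ∈ T → (x, y, z') ∈ T → z = z')
    (δ : A2TildeGroup T → ℕ × ℕ)
    (hδ : ∀ (w : A2TildeGroup T) (m n : ℕ),
      δ w = (m, n) ↔ ∃ xs ys : List P, IsRNF σ T w xs ys ∧ xs.length = m ∧ ys.length = n) :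
    (∀ (w : A2TildeGroup T) (m n : ℕ × ℕ), δ w = m + n →
      ∃! hk : A2TildeGroup T × A2TildeGroup T,
        w = hk.1 * hk.2 ∧ δ hk.1 = m ∧ δ hk.2 = n) ∧
    (∀ w h k : A2TildeGroup T, δ (w * h * k) = δ w + δ h + δ k →
      δ (w * h) = δ w + δ h ∧ δ (h * k) = δ h + δ k) := by
  have nfδ : ∀ w xs ys, A2Base.NF (a T) (fun x y => y ∈ σ x) w xs ys →
      δ w = (xs.length, ys.length) :=
    fun w xs ys h => (hδ w _ _).2 ⟨xs, ys, h, rfl, rfl⟩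
  have exNF : ∀ w, ∃ xs ys, A2Base.NF (a T) (fun x y => y ∈ σ x) w xs ys ∧
      xs.length = (δ w).1 ∧ ys.length = (δ w).2 :=
    fun w => (hδ w (δ w).1 (δ w).2).1 rfl
  have B : A2Base (a T) (fun x y => y ∈ σ x) (fun x y z => (x, y, z) ∈ T) := by
    refine ⟨?_, hT2, hT3, fun x y => (hT1 x y).symm, ?_, ?_, ?_⟩
    · intro x y z h
      have := PresentedGroup.one_of_mem (rels := A2Rels T)
        (x := FreeGroup.of x * FreeGroup.of y * FreeGroup.of z) ⟨(x, y, z), h, rfl⟩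
      simpa [a, PresentedGroup.of] using this
    · intro x x' h
      have := Configuration.HasLines.mkLine_ax (L := L) h
      exact ⟨σ.symm (Configuration.HasLines.mkLine h), by simpa using this⟩
    · intro x x' h
      exact ⟨_, Configuration.HasPoints.mkPoint_ax (P := P) (σ.injective.ne h)⟩
    · intro x y u v h1 h2 h3 h4
      rcases Configuration.Nondegenerate.eq_or_eq h1 h2 h3 h4 with h | h
      · exact Or.inr h
      · exact Or.inl (σ.injective h)
  -- deleting the last negative letter
  have del : ∀ w xs ys y, A2Base.NF (a T) (fun x y => y ∈ σ x) w xs (ys ++ [y]) →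
      A2Base.NF (a T) (fun x y => y ∈ σ x) (w * a T y) xs ys := by
    rintro w xs ys y ⟨h1, h2, h3, h4⟩
    refine ⟨by rw [h1]; simp [mul_assoc], h2, (List.isChain_append.1 h3).1, ?_⟩
    intro x hx z hz
    apply h4 x hx
    cases ys with
    | nil => simp at hz
    | cons c l => simpa using hz
  have snoc : ∀ (ys : List P) y, y ∈ ys.getLast? → ∃ zs, ys = zs ++ [y] := by
    intro ys y h
    rw [Option.mem_def, List.getLast?_eq_some_iff] at h
    exact h
  have H : A2Ax (a T) (fun x y => y ∈ σ x) (fun x y z => (x, y, z) ∈ T) δ := by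
    refine ⟨B, ?_, ?_, ?_, ?_, ?_, ?_⟩
    · exact nfδ 1 [] [] ⟨by simp, by simp, by simp, by simp⟩
    · intro w h1 h2
      obtain ⟨xs, ys, h, e1, e2⟩ := exNF w
      rw [h1, List.length_eq_zero_iff] at e1
      rw [h2, List.length_eq_zero_iff] at e2
      subst e1 e2
      simpa using h.1
    · intro w x
      obtain ⟨xs, ys, h, e1, e2⟩ := exNF w
      by_cases hx : ∀ y ∈ ys.getLast?, y ≠ x
      · obtain ⟨xs', ys', h', e'⟩ := B.lemmaR h x hx
        rw [nfδ _ _ _ h']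
        simp only
        omega
      · push Not at hx
        obtain ⟨y, hy, rfl⟩ := hx
        obtain ⟨zs, rfl⟩ := snoc _ _ hy
        rw [nfδ _ _ _ (del _ _ _ _ h)]
        simp at e2 ⊢
        omega
    · intro w x x' h1 h2 h1' h2'
      obtain ⟨xs, ys, h, e1, e2⟩ := exNF w
      have key : ∀ x, (δ (w * a T x)).1 = (δ w).1 → (δ (w * a T x)).2 + 1 = (δ w).2 →
          x ∈ ys.getLast? := by
        intro x k1 k2
        by_contra hc
        obtain ⟨xs', ys', h', e'⟩ := B.lemmaR h x (by rintro y hy rfl; exact hc hy)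
        rw [nfδ _ _ _ h'] at k1 k2
        simp only at k1 k2
        omega
      exact Option.mem_unique (key x h1 h2) (key x' h1' h2')
    · intro w n hn
      obtain ⟨xs, ys, h, e1, e2⟩ := exNF w
      obtain ⟨y, hy⟩ : ∃ y, y ∈ ys.getLast? := by
        have : ys ≠ [] := by rintro rfl; simp at e2; omega
        exact ⟨_, List.getLast?_eq_some_getLast this⟩
      obtain ⟨zs, rfl⟩ := snoc _ _ hy
      refine ⟨w * a T y, y, by group, ?_⟩
      rw [nfδ _ _ _ (del _ _ _ _ h)]
      simp at e2 ⊢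
      omega
    · intro w m hm hn
      obtain ⟨xs, ys, h, e1, e2⟩ := exNF w
      rw [hn, List.length_eq_zero_iff] at e2
      subst e2
      obtain ⟨x, hx⟩ : ∃ y, y ∈ xs.getLast? := by
        have : xs ≠ [] := by rintro rfl; simp at e1; omega
        exact ⟨_, List.getLast?_eq_some_getLast this⟩
      obtain ⟨zs, rfl⟩ := snoc _ _ hx
      obtain ⟨h1, h2, h3, h4⟩ := h
      have hz : A2Base.NF (a T) (fun x y => y ∈ σ x) (zs.map fun x => a T x).prod zs [] :=
        ⟨by simp, (List.isChain_append.1 h2).1, by simp, by simp⟩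
      refine ⟨(zs.map fun x => a T x).prod, x, by rw [h1]; simp, ?_, ?_, ?_⟩
      · rw [nfδ _ _ _ hz]; simp at e1 ⊢; omega
      · rw [nfδ _ _ _ hz]; simp
      · intro z hxz
        have : A2Base.NF (a T) (fun x y => y ∈ σ x) (w * a T z) ((zs ++ [x]) ++ [z]) [] := by
          refine ⟨by rw [h1]; simp [mul_assoc], ?_, by simp, by simp⟩
          rw [List.isChain_append]
          refine ⟨h2, by simp, ?_⟩
          intro x1 hx1 y1 hy1
          simp at hx1 hy1
          subst hx1 hy1
          exact hxz
        rw [nfδ _ _ _ this]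
        simp at e1 ⊢
        omega
  refine ⟨?_, H.part2⟩
  intro w m n e
  obtain ⟨h, k, e1, e2, e3⟩ := H.exist _ w m n rfl e
  refine ⟨(h, k), ⟨e1, e2, e3⟩, ?_⟩
  rintro ⟨h', k'⟩ ⟨f1, f2, f3⟩
  simp only at f1 f2 f3
  obtain ⟨r1, r2⟩ := H.unique _ h k h' k' rfl (e1.symm.trans f1)
    (by rw [← e1, e, e2, e3]) (e2.trans f2.symm) (e3.trans f3.symm)
  rw [r1, r2]
end

section
/- Let Γ_𝒯 be the A₂-tilde group of a finite projective plane (P, L) with bijection σ : P ≃ L and compatible triella 𝒯, and let δ : Γ_𝒯 → ℕ × ℕ be the shape function. Let n ≥ 1 and let w₀, w₁, …, w_n ∈ Γ_𝒯 satisfy δ(w_i·w_{i+1}) = δ(w_i) + δ(w_{i+1}) for all 0 ≤ i < n and (1,1) ≤ δ(w_i) componentwise for all 0 < i < n. Then δ(w₀·w₁·⋯·w_n) = δ(w₀) + δ(w₁) + ⋯ + δ(w_n). -/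
namespace A2Aux

variable {G P : Type} [Group G]

/-- Evaluation of a signed word. -/
def ev (b : P → G) : List (P × Bool) → G
  | [] => 1
  | (x, true) :: w => b x * ev b w
  | (x, false) :: w => (b x)⁻¹ * ev b w

/-- Number of positive and negative letters. -/
def cnt : List (P × Bool) → ℕ × ℕ
  | [] => (0, 0)
  | (_, true) :: w => ((cnt w).1 + 1, (cnt w).2)
  | (_, false) :: w => ((cnt w).1, (cnt w).2 + 1)

/-- The word with positive part `xs` and negative part `ys`. -/
def wd (xs ys : List P) : List (P × Bool) :=
  xs.map (fun x => (x, true)) ++ ys.map (fun y => (y, false))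

/-- Shape conditions for a normal form. -/
def RN (R : P → P → Prop) (xs ys : List P) : Prop :=
  List.IsChain (fun p q => ¬ R p q) xs ∧ List.IsChain (fun p q => ¬ R q p) ys ∧
    (∀ x ∈ xs.getLast?, ∀ y ∈ ys.head?, x ≠ y)

/-- Abstract self-dual setting. -/
structure Sys (b : P → G) (R : P → P → Prop) (D : G → ℕ × ℕ) : Prop where
  red : ∀ x y, R x y → ∃ z, b x * b y = (b z)⁻¹
  flp : ∀ x y, x ≠ y → ∃ u v, (b x)⁻¹ * b y = b u * (b v)⁻¹
  flp2 : ∀ x y, x ≠ y → ∃ u v, b x * (b y)⁻¹ = (b u)⁻¹ * b v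
  rn : ∀ xs ys, RN R xs ys → D (ev b (wd xs ys)) = (xs.length, ys.length)
  ln : ∀ ts ss, RN (fun x y => R y x) ts ss →
    D (ev (fun x => (b x)⁻¹) (wd ts ss)) = (ss.length, ts.length)
  gen : ∀ g, ∃ w, ev b w = g

theorem ev_append (b : P → G) (u v : List (P × Bool)) : ev b (u ++ v) = ev b u * ev b v := by
  induction u with
  | nil => simp [ev]
  | cons l u ih => rcases l with ⟨x, _ | _⟩ <;> simp [ev, ih, mul_assoc]

theorem cnt_append (u v : List (P × Bool)) : cnt (u ++ v) = cnt u + cnt v := by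
  induction u with
  | nil => simp [cnt]
  | cons l u ih =>
    rcases l with ⟨x, _ | _⟩ <;> ext <;> simp [cnt, ih] <;> omega

theorem cnt_len (u : List (P × Bool)) : (cnt u).1 + (cnt u).2 = u.length := by
  induction u with
  | nil => simp [cnt]
  | cons l u ih => rcases l with ⟨x, _ | _⟩ <;> simp [cnt] <;> omega

theorem cnt_wd (xs ys : List P) : cnt (wd xs ys) = (xs.length, ys.length) := by
  have h1 : cnt (xs.map (fun x => (x, true))) = (xs.length, 0) := by
    induction xs with
    | nil => simp [cnt]
    | cons l u ih => simp [cnt, ih]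
  have h2 : cnt (ys.map (fun x => (x, false))) = (0, ys.length) := by
    induction ys with
    | nil => simp [cnt]
    | cons l u ih => simp [cnt, ih]
  simp [wd, cnt_append, h1, h2]

theorem wd_len (xs ys : List P) : (wd xs ys).length = xs.length + ys.length := by simp [wd]

theorem wd_cons (x : P) (xs ys : List P) : wd (x :: xs) ys = (x, true) :: wd xs ys := by simp [wd]

theorem wd_nil_cons (y : P) (ys : List P) :
    wd ([] : List P) (y :: ys) = (y, false) :: wd [] ys := by simp [wd]

/-- swap all signs -/
def neg (w : List (P × Bool)) : List (P × Bool) := w.map fun l => (l.1, !l.2)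

theorem ev_neg (b : P → G) (w : List (P × Bool)) :
    ev (fun x => (b x)⁻¹) (neg w) = ev b w := by
  induction w with
  | nil => simp [ev, neg]
  | cons l u ih =>
    have : neg (l :: u) = (l.1, !l.2) :: neg u := rfl
    rw [this]
    rcases l with ⟨x, _ | _⟩ <;> simp [ev, ih]

theorem Sys.dual {b : P → G} {R : P → P → Prop} {D : G → ℕ × ℕ} (S : Sys b R D) :
    Sys (fun x => (b x)⁻¹) (fun x y => R y x) (fun g => (D g).swap) where
  red x y h := by
    obtain ⟨z, hz⟩ := S.red y x h
    refine ⟨z, ?_⟩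
    rw [← hz]; simp
  flp x y h := by simpa using S.flp2 x y h
  flp2 x y h := by simpa using S.flp x y h
  rn xs ys h := by simp [S.ln xs ys h]
  ln ts ss h := by
    have := S.rn ts ss h
    simp [this]
  gen g := by
    obtain ⟨w, hw⟩ := S.gen g
    exact ⟨neg w, by rw [ev_neg, hw]⟩

variable {b : P → G} {R : P → P → Prop} {D : G → ℕ × ℕ}

/-- Conclusion of the rewriting lemma. -/
def Conc (b : P → G) (R : P → P → Prop) (g : G) (c : ℕ × ℕ) (h : Option (P × Bool)) : Prop :=
  ∃ xs ys, RN R xs ys ∧ ev b (wd xs ys) = g ∧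
    (((xs.length, ys.length) = c ∧ ∀ x, h = some (x, true) → xs.head? = some x) ∨
      xs.length + ys.length < c.1 + c.2)

theorem RN.tail_right {xs ys : List P} {y : P} (h : RN R xs (y :: ys)) :
    RN R [] ys := by
  obtain ⟨h1, h2, h3⟩ := h
  refine ⟨List.isChain_nil, h2.tail, by simp⟩

theorem RN.tail_left {xs ys : List P} {x : P} (h : RN R (x :: xs) ys) :
    RN R xs ys := by
  obtain ⟨h1, h2, h3⟩ := h
  refine ⟨h1.tail, h2, ?_⟩
  intro u hu y hy
  refine h3 u ?_ y hy
  cases xs with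
  | nil => simp at hu
  | cons v xs => simpa using hu

theorem RN.cons_left {xs ys : List P} {x x1 : P} (h : RN R (x1 :: xs) ys) (hx : ¬ R x x1) :
    RN R (x :: x1 :: xs) ys := by
  obtain ⟨h1, h2, h3⟩ := h
  refine ⟨List.isChain_cons_cons.2 ⟨hx, h1⟩, h2, ?_⟩
  intro u hu y hy
  exact h3 u (by simpa using hu) y hy

theorem conc_short {N : ℕ} (IH : ∀ w : List (P × Bool), w.length < N →
      Conc b R (ev b w) (cnt w) w.head?) {g : G} {c : ℕ × ℕ} {h : Option (P × Bool)}
    (w : List (P × Bool)) (hw : w.length < N) (hc : w.length < c.1 + c.2) (he : ev b w = g) :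
    Conc b R g c h := by
  obtain ⟨xs, ys, h1, h2, h3⟩ := IH w hw
  refine ⟨xs, ys, h1, h2.trans he, Or.inr ?_⟩
  have := cnt_len w
  rcases h3 with ⟨h3, -⟩ | h3
  · rw [← h3] at this
    simp only at this
    omega
  · omega

theorem conc_pos (S : Sys b R D) {N : ℕ} (IH : ∀ w : List (P × Bool), w.length < N →
      Conc b R (ev b w) (cnt w) w.head?) (x : P) (xs ys : List P) (h : RN R xs ys)
    (hN : xs.length + ys.length < N) :
    Conc b R (b x * ev b (wd xs ys)) (xs.length + 1, ys.length) (some (x, true)) := by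
  cases xs with
  | nil =>
    cases ys with
    | nil => exact ⟨[x], [], by simp [RN], by simp [wd, ev], by simp⟩
    | cons y ys =>
      by_cases hxy : x = y
      · subst hxy
        refine ⟨[], ys, h.tail_right, by simp [wd, ev], Or.inr ?_⟩
        simp; omega
      · refine ⟨[x], y :: ys, ⟨by simp, h.2.1, by simpa using hxy⟩, by simp [wd, ev], by simp⟩
  | cons x1 xs =>
    by_cases hR : R x x1
    · obtain ⟨z, hz⟩ := S.red x x1 hR
      refine conc_short IH ((z, false) :: wd xs ys) ?_ ?_ ?_
      · simp [wd_len] at hN ⊢; omega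
      · simp [wd_len]; omega
      · simp [wd_cons, ev, ← hz, mul_assoc]
    · exact ⟨x :: x1 :: xs, ys, h.cons_left hR, by simp [wd, ev], by simp⟩

theorem rewrite (S : Sys b R D) (w : List (P × Bool)) : Conc b R (ev b w) (cnt w) w.head? := by
  induction hN : w.length using Nat.strong_induction_on generalizing w with
  | _ N IH0 =>
  have IH : ∀ w : List (P × Bool), w.length < N → Conc b R (ev b w) (cnt w) w.head? :=
    fun w hw => IH0 _ hw w rfl
  clear IH0
  cases w with
  | nil => exact ⟨[], [], by simp [RN], by simp [wd, ev], by simp [cnt]⟩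
  | cons l w =>
    simp only [List.length_cons] at hN
    have hcl := cnt_len w
    obtain ⟨xs, ys, h1, h2, h3⟩ := IH w (by omega)
    rcases h3 with ⟨h3, -⟩ | h3
    · rw [← h3] at hcl
      simp only at hcl
      rcases l with ⟨t, _ | _⟩
      · -- negative letter
        simp only [ev, cnt, ← h3, ← h2]
        cases xs with
        | nil =>
          cases ys with
          | nil => exact ⟨[], [t], by simp [RN], by simp [wd, ev], by simp⟩
          | cons y ys =>
            by_cases hR : R y t
            · obtain ⟨z, hz⟩ := S.red y t hR
              refine conc_short IH ((z, true) :: wd [] ys) ?_ ?_ ?_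
              · simp [wd_len] at hcl ⊢; omega
              · simp [wd_len]
              · have hz' : b z = (b t)⁻¹ * (b y)⁻¹ := by rw [← mul_inv_rev, hz, inv_inv]
                simp [wd_nil_cons, ev, hz', mul_assoc]
            · refine ⟨[], t :: y :: ys, ⟨by simp, List.isChain_cons_cons.2 ⟨hR, h1.2.1⟩, by simp⟩,
                by simp [wd, ev], by simp⟩
        | cons x1 xs =>
          by_cases htx : t = x1
          · subst htx
            refine ⟨xs, ys, h1.tail_left, by simp [wd_cons, ev], Or.inr ?_⟩
            simp; omega
          · obtain ⟨u, v, huv⟩ := S.flp t x1 htx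
            have hev : (b t)⁻¹ * ev b (wd (x1 :: xs) ys) = b u * ev b ((v, false) :: wd xs ys) := by
              simp only [wd_cons, ev]
              rw [← mul_assoc, huv, mul_assoc]
            rw [hev]
            have hlen : ((v, false) :: wd xs ys).length < N := by
              simp [wd_len] at hcl ⊢; omega
            obtain ⟨xs', ys', k1, k2, k3⟩ := IH _ hlen
            have hcc := cnt_len ((v, false) :: wd xs ys)
            rw [← k2]
            rcases k3 with ⟨k3, -⟩ | k3
            · rw [← k3] at hcc
              simp only at hcc
              obtain ⟨as, bs, m1, m2, m3⟩ := conc_pos S IH u xs' ys' k1 (by omega)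
              simp only [cnt, cnt_wd, Prod.mk.injEq] at k3
              refine ⟨as, bs, m1, m2, ?_⟩
              rcases m3 with ⟨m3, -⟩ | m3
              · left
                simp only [Prod.mk.injEq] at m3
                refine ⟨?_, by simp⟩
                simp only [List.length_cons, Prod.mk.injEq]
                omega
              · right
                simp only [List.length_cons] at m3 ⊢
                omega
            · refine conc_short IH ((u, true) :: wd xs' ys') ?_ ?_ ?_
              · simp [wd_len] at hcl hcc ⊢; omega
              · simp [wd_len] at hcl hcc ⊢; omega
              · simp [ev]
      · -- positive letter
        simp only [ev, cnt, ← h3, ← h2]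
        exact conc_pos S IH t xs ys h1 (by omega)
    · have hc : (cnt (l :: w)).1 + (cnt (l :: w)).2 = w.length + 1 := by
        simpa using cnt_len (l :: w)
      refine conc_short IH (l :: wd xs ys) ?_ ?_ ?_
      · simp [wd_len]; omega
      · rw [hc]; simp [wd_len]; omega
      · rcases l with ⟨t, _ | _⟩ <;> simp [ev, h2]

/-- length -/
def len (D : G → ℕ × ℕ) (g : G) : ℕ := (D g).1 + (D g).2

theorem word_shape (S : Sys b R D) (w : List (P × Bool)) :
    D (ev b w) = cnt w ∨ len D (ev b w) < w.length := by
  obtain ⟨xs, ys, h1, h2, h3⟩ := rewrite S w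
  have := S.rn xs ys h1
  rw [h2] at this
  rcases h3 with ⟨h3, -⟩ | h3
  · left; rw [this, h3]
  · right; rw [cnt_len] at h3; simp [len, this, h3]

theorem exists_rn (S : Sys b R D) (g : G) :
    ∃ xs ys, RN R xs ys ∧ ev b (wd xs ys) = g ∧ D g = (xs.length, ys.length) := by
  obtain ⟨w, rfl⟩ := S.gen g
  obtain ⟨xs, ys, h1, h2, -⟩ := rewrite S w
  exact ⟨xs, ys, h1, h2, h2 ▸ S.rn xs ys h1⟩

theorem exists_word (S : Sys b R D) (g : G) :
    ∃ w, ev b w = g ∧ D g = cnt w := by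
  obtain ⟨xs, ys, h1, h2, h3⟩ := exists_rn S g
  exact ⟨_, h2, by rw [h3, cnt_wd]⟩

theorem len_le (S : Sys b R D) (w : List (P × Bool)) : len D (ev b w) ≤ w.length := by
  rcases word_shape S w with h | h
  · rw [len, h, cnt_len]
  · exact h.le

theorem left_ext (S : Sys b R D) (x : P) (g h : G) (hg : 1 ≤ (D g).1)
    (h1 : D (b x * g) = D g + (1, 0)) (h2 : D (g * h) = D g + D h) :
    D (b x * (g * h)) = D (g * h) + (1, 0) := by
  obtain ⟨xs, ys, k1, k2, k3⟩ := exists_rn S g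
  obtain ⟨wh, m1, m2⟩ := exists_word S h
  cases xs with
  | nil => simp [k3] at hg
  | cons x1 xs =>
    have hR : ¬ R x x1 := by
      intro hR
      obtain ⟨z, hz⟩ := S.red x x1 hR
      have := len_le S ((z, false) :: wd xs ys)
      have he : ev b ((z, false) :: wd xs ys) = b x * g := by
        rw [← k2]; simp [wd_cons, ev, ← hz, mul_assoc]
      rw [he, len, h1, k3] at this
      simp [wd_len] at this
      omega
    obtain ⟨as, bs, n1, n2, n3⟩ := rewrite S (wd (x1 :: xs) ys ++ wh)
    rw [ev_append, k2, m1] at n2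
    have hD := S.rn as bs n1
    rw [n2] at hD
    rw [cnt_append, cnt_wd, ← k3, ← m2, ← h2, hD] at n3
    rcases n3 with ⟨-, n3⟩ | n3
    · have := n3 x1 (by simp [wd_cons])
      cases as with
      | nil => simp at this
      | cons a0 as =>
        simp at this
        subst this
        have := S.rn _ _ (n1.cons_left hR)
        rw [wd_cons] at this
        simp only [ev] at this
        rw [n2] at this
        rw [this, hD]; simp
    · simp at n3

theorem left_ext_neg (S : Sys b R D) (x : P) (g h : G) (hg : 1 ≤ (D g).2)
    (h1 : D ((b x)⁻¹ * g) = D g + (0, 1)) (h2 : D (g * h) = D g + D h) :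
    D ((b x)⁻¹ * (g * h)) = D (g * h) + (0, 1) := by
  have := left_ext S.dual x g h (by simpa using hg) (by simp [h1, Prod.ext_iff])
    (by simp [h2, Prod.ext_iff])
  simp only [Prod.ext_iff, Prod.fst_swap, Prod.snd_swap, Prod.fst_add, Prod.snd_add] at this ⊢
  exact ⟨this.2, this.1⟩

theorem three (S : Sys b R D) (g h : G) (hg : (1, 1) ≤ D g) (h2 : D (g * h) = D g + D h)
    (w : List (P × Bool)) (h1 : D (ev b w * g) = cnt w + D g) :
    D (ev b w * g * h) = cnt w + D g + D h := by
  induction w with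
  | nil => simpa [ev, cnt, Prod.ext_iff] using h2
  | cons l w ih =>
    obtain ⟨v, v1, v2⟩ := exists_word S g
    have key : D (ev b w * g) = cnt w + D g := by
      rcases word_shape S (w ++ v) with k | k
      · rw [ev_append, cnt_append, v1, ← v2] at k
        exact k
      · exfalso
        obtain ⟨u, u1, u2⟩ := exists_word S (ev b (w ++ v))
        have hu := cnt_len u
        have := len_le S (l :: u)
        have e : ev b (l :: u) = ev b (l :: w) * g := by
          rw [← v1, ← ev_append]
          rcases l with ⟨t, _ | _⟩ <;> simp [ev, u1]
        rw [e, len, h1, v2] at this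
        rw [len, u2] at k
        have c1 := cnt_len (l :: w)
        have c2 := cnt_len v
        simp at this c1 k
        omega
    have ih := ih key
    have hg' : 1 ≤ (D g).1 ∧ 1 ≤ (D g).2 := hg
    have hs : D (ev b w * g * h) = D (ev b w * g) + D h := by rw [ih, key]
    rcases l with ⟨t, _ | _⟩
    · have := left_ext_neg S t (ev b w * g) h (by rw [key]; simp; omega) (by
        simp only [ev, cnt, mul_assoc] at h1 ⊢ key
        rw [h1, key]; ext <;> simp; omega) hs
      simp only [ev, cnt, mul_assoc] at this ih ⊢
      rw [this, ih]; ext <;> simp; omega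
    · have := left_ext S t (ev b w * g) h (by rw [key]; simp; omega) (by
        simp only [ev, cnt, mul_assoc] at h1 ⊢ key
        rw [h1, key]; ext <;> simp; omega) hs
      simp only [ev, cnt, mul_assoc] at this ih ⊢
      rw [this, ih]; ext <;> simp; omega

theorem three' (S : Sys b R D) (f g h : G) (hg : (1, 1) ≤ D g) (h1 : D (f * g) = D f + D g)
    (h2 : D (g * h) = D g + D h) : D (f * g * h) = D (f * g) + D h := by
  obtain ⟨w, rfl, hw⟩ := exists_word S f
  rw [three S g h hg h2 w (by rw [h1, hw]), h1, hw]

theorem chain (S : Sys b R D) (n : ℕ) : ∀ (u : G) (w : Fin (n + 1) → G),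
    D (u * w 0) = D u + D (w 0) →
    (∀ i : Fin n, D (w i.castSucc * w i.succ) = D (w i.castSucc) + D (w i.succ)) →
    (∀ i : Fin (n + 1), (i : ℕ) < n → (1, 1) ≤ D (w i)) →
    D (u * (List.ofFn w).prod) = D u + ∑ i, D (w i) := by
  induction n with
  | zero => intro u w h _ _; simpa using h
  | succ n ih =>
    intro u w h hadd hmid
    have h0 := three' S u (w 0) (w 1) (hmid 0 (by simp)) h (by simpa using hadd 0)
    have := ih (u * w 0) (fun i => w i.succ) (by simpa using h0)
      (fun i => by simpa using hadd i.succ) (fun i hi => hmid _ (by simpa using hi))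
    rw [List.ofFn_succ, List.prod_cons, ← mul_assoc, this, h, Fin.sum_univ_succ (fun i => D (w i)), add_assoc]

/-- Elementary square `t⁻¹ s = p q⁻¹`. -/
def Sq (T : Set (P × P × P)) (t s p q : P) : Prop :=
  t ≠ s ∧ ∃ z, (z, t, p) ∈ T ∧ (z, s, q) ∈ T

/-- Pushing a negative letter through a positive word. -/
inductive Push (T : Set (P × P × P)) : P → List P → List P → P → Prop
  | nil (t : P) : Push T t [] [] t
  | cons {t s p q r : P} {S S' : List P} :
      Sq T t s p q → Push T q S S' r → Push T t (s :: S) (p :: S') r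

/-- Combinatorial hypotheses. -/
structure Tri (T : Set (P × P × P)) (R : P → P → Prop) : Prop where
  t1 : ∀ x y, (∃ z, (x, y, z) ∈ T) ↔ R x y
  t2 : ∀ x y z, (x, y, z) ∈ T → (y, z, x) ∈ T
  t3 : ∀ x y z z', (x, y, z) ∈ T → (x, y, z') ∈ T → z = z'
  line : ∀ x y, x ≠ y → ∃ z, R z x ∧ R z y
  point : ∀ x y, x ≠ y → ∃ z, R x z ∧ R y z
  uniq : ∀ p q z z', p ≠ q → R p z → R q z → R p z' → R q z' → z = z'

variable {T : Set (P × P × P)}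

theorem Tri.r (H : Tri T R) {x y z : P} (h : (x, y, z) ∈ T) : R x y := (H.t1 x y).1 ⟨z, h⟩

theorem Sq.ne (H : Tri T R) {t s p q : P} (h : Sq T t s p q) : p ≠ q := by
  rintro rfl
  obtain ⟨hne, z, h1, h2⟩ := h
  exact hne (H.t3 _ _ _ _ (H.t2 _ _ _ (H.t2 _ _ _ h1)) (H.t2 _ _ _ (H.t2 _ _ _ h2)))

theorem Sq.exists (H : Tri T R) {t s : P} (h : t ≠ s) : ∃ p q, Sq T t s p q := by
  obtain ⟨z, h1, h2⟩ := H.line t s h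
  obtain ⟨p, hp⟩ := (H.t1 _ _).2 h1
  obtain ⟨q, hq⟩ := (H.t1 _ _).2 h2
  exact ⟨p, q, h, z, hp, hq⟩

theorem Sq.hor (H : Tri T R) {t s p q t0 p' q0 : P} (h : Sq T t s p q) (h' : Sq T t0 p p' q0)
    (ht : ¬ R t t0) : ¬ R q q0 := by
  intro hq
  have hpq := h.ne H
  obtain ⟨hne, z, h1, h2⟩ := h
  obtain ⟨hne', z', h1', h2'⟩ := h'
  have e1 := H.t2 _ _ _ (H.t2 _ _ _ h1)
  have e2 := H.t2 _ _ _ (H.t2 _ _ _ h2)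
  have e3 := H.t2 _ _ _ h2'
  obtain rfl := H.uniq p q z q0 hpq (H.r e1) (H.r e2) (H.r e3) hq
  obtain rfl := H.t3 _ _ _ _ e1 e3
  exact ht (H.r h1')

theorem Sq.ver (H : Tri T R) {t s p q s2 p2 q2 : P} (h : Sq T t s p q) (h' : Sq T q s2 p2 q2)
    (ht : ¬ R s s2) : ¬ R p p2 := by
  intro hq
  have hpq := h.ne H
  obtain ⟨hne, z, h1, h2⟩ := h
  obtain ⟨hne', z', h1', h2'⟩ := h'
  have e1 := H.t2 _ _ _ (H.t2 _ _ _ h1)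
  have e2 := H.t2 _ _ _ (H.t2 _ _ _ h2)
  have e3 := H.t2 _ _ _ h1'
  obtain rfl := H.uniq p q z p2 hpq (H.r e1) (H.r e2) hq (H.r e3)
  obtain rfl := H.t3 _ _ _ _ e2 e3
  exact ht (H.r h2')

theorem Push.exists (H : Tri T R) (S : List P) : ∀ t, (∀ s ∈ S.head?, t ≠ s) →
    List.IsChain (fun p q => ¬ R p q) S → ∃ S' r, Push T t S S' r := by
  induction S with
  | nil => intro t _ _; exact ⟨[], t, Push.nil t⟩
  | cons s S ih =>
    intro t ht hc
    obtain ⟨p, q, hs⟩ := Sq.exists H (ht s (by simp))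
    obtain ⟨S', r, h⟩ := ih q (by
      intro s2 hs2 e
      subst e
      obtain ⟨-, z, -, h2⟩ := hs
      cases S with
      | nil => simp at hs2
      | cons s3 S =>
        simp at hs2
        subst hs2
        exact (List.isChain_cons_cons.1 hc).1 (H.r (H.t2 _ _ _ h2))) hc.tail
    exact ⟨_, _, Push.cons hs h⟩

theorem Push.length {t r : P} {S S' : List P} (h : Push T t S S' r) : S'.length = S.length := by
  induction h with
  | nil => rfl
  | cons _ _ ih => simp [ih]

theorem Push.chain (H : Tri T R) {t r : P} {S S' : List P} (h : Push T t S S' r)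
    (hc : List.IsChain (fun p q => ¬ R p q) S) : List.IsChain (fun p q => ¬ R p q) S' := by
  induction h with
  | nil => simp
  | cons hs h ih =>
    have := ih hc.tail
    cases h with
    | nil => simp
    | cons hs' h' =>
      exact List.isChain_cons_cons.2 ⟨hs.ver H hs' (List.isChain_cons_cons.1 hc).1, this⟩

theorem Push.last (H : Tri T R) {t r : P} {S S' : List P} (h : Push T t S S' r) :
    ∀ x ∈ S'.getLast?, x ≠ r := by
  induction h with
  | nil => simp
  | cons hs h ih =>
    cases h with
    | nil => simpa using hs.ne H
    | cons hs' h' => simpa using ih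

theorem Push.hor (H : Tri T R) {t r : P} {S S' : List P} (h : Push T t S S' r) :
    ∀ {t0 S'' r0}, Push T t0 S' S'' r0 → ¬ R t t0 → ¬ R r r0 := by
  induction h with
  | nil => intro t0 S'' r0 h; cases h; exact id
  | cons hs h ih =>
    intro t0 S'' r0 h0 ht
    cases h0 with
    | cons hs0 h0 => exact ih h0 (hs.hor H hs0 ht)

theorem Push.head (H : Tri T R) {t r : P} {S S' : List P} (h : Push T t S S' r) :
    ∀ x ∈ S'.head?, R t x := by
  cases h with
  | nil => simp
  | cons hs h =>
    obtain ⟨-, z, h1, h2⟩ := hs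
    simpa using H.r (H.t2 _ _ _ h1)

theorem sq_eval (b : P → G) (hb : ∀ x y z, (x, y, z) ∈ T → b x * b y * b z = 1) {t s p q : P}
    (h : Sq T t s p q) : (b t)⁻¹ * b s = b p * (b q)⁻¹ := by
  obtain ⟨-, z, h1, h2⟩ := h
  have e1 := hb _ _ _ h1
  have e2 := hb _ _ _ h2
  rw [mul_assoc, mul_eq_one_iff_eq_inv'] at e1 e2
  rw [eq_mul_inv_iff_mul_eq, mul_assoc, e2, ← e1]; simp

theorem push_eval (b : P → G) (hb : ∀ x y z, (x, y, z) ∈ T → b x * b y * b z = 1) {t r : P}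
    {S S' : List P} (h : Push T t S S' r) (ys : List P) :
    (b t)⁻¹ * ev b (wd S ys) = ev b (wd S' (r :: ys)) := by
  induction h with
  | nil => simp [wd, ev]
  | cons hs h ih =>
    simp only [wd_cons, ev]
    rw [← mul_assoc, sq_eval b hb hs, mul_assoc, ih]

theorem ln_to_rn (H : Tri T R) (b : P → G) (hb : ∀ x y z, (x, y, z) ∈ T → b x * b y * b z = 1)
    (ss : List P) (hss : List.IsChain (fun p q => ¬ R p q) ss) (ts : List P) :
    ∀ t, RN (fun x y => R y x) (t :: ts) ss →
    ∃ X1 X r Y, Push T t X1 X r ∧ ev (fun x => (b x)⁻¹) (wd (t :: ts) ss) = ev b (wd X (r :: Y)) ∧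
      X.length = ss.length ∧ Y.length = ts.length ∧ RN R X (r :: Y) := by
  induction ts with
  | nil =>
    intro t h
    obtain ⟨S', r, hp⟩ := Push.exists H ss t (by simpa using h.2.2) hss
    refine ⟨ss, S', r, [], hp, ?_, hp.length, rfl, hp.chain H hss, by simp, ?_⟩
    · rw [← push_eval b hb hp, wd_cons]
      simp only [ev]
      congr 1
      rw [← ev_neg]
      simp [neg, wd, Function.comp_def]
    · simpa using hp.last H
  | cons t1 ts ih =>
    intro t h
    obtain ⟨X1, X, r, Y, hp, he, hX, hY, hr⟩ := ih t1 h.tail_left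
    have htt : ¬ R t1 t := (List.isChain_cons_cons.1 h.1).1
    obtain ⟨S', r', hp'⟩ := Push.exists H X t
      (fun s hs e => htt (e ▸ hp.head H s hs)) hr.1
    refine ⟨X, S', r', r :: Y, hp', ?_, by rw [hp'.length, hX], by simp [hY], hp'.chain H hr.1,
      List.isChain_cons_cons.2 ⟨hp.hor H hp' htt, hr.2.1⟩, by simpa using hp'.last H⟩
    rw [← push_eval b hb hp', wd_cons]
    simp only [ev]
    rw [he]

theorem mkSys (H : Tri T R) (b : P → G) (hb : ∀ x y z, (x, y, z) ∈ T → b x * b y * b z = 1)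
    (hrn : ∀ xs ys, RN R xs ys → D (ev b (wd xs ys)) = (xs.length, ys.length))
    (hgen : ∀ g, ∃ w, ev b w = g) : Sys b R D where
  red x y h := by
    obtain ⟨z, hz⟩ := (H.t1 x y).2 h
    exact ⟨z, mul_eq_one_iff_eq_inv.1 (hb _ _ _ hz)⟩
  flp x y h := by
    obtain ⟨p, q, hs⟩ := Sq.exists H h
    exact ⟨p, q, sq_eval b hb hs⟩
  flp2 x y h := by
    obtain ⟨z, h1, h2⟩ := H.point x y h
    obtain ⟨u, hu⟩ := (H.t1 _ _).2 h1
    obtain ⟨v, hv⟩ := (H.t1 _ _).2 h2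
    have e1 := hb _ _ _ (H.t2 _ _ _ (H.t2 _ _ _ hu))
    have e2 := hb _ _ _ (H.t2 _ _ _ (H.t2 _ _ _ hv))
    have : b u * b x = b v * b y := mul_right_cancel (e1.trans e2.symm)
    refine ⟨u, v, ?_⟩
    rw [mul_inv_eq_iff_eq_mul, mul_assoc, ← this]; simp
  rn := hrn
  ln ts ss h := by
    cases ts with
    | nil =>
      have := hrn ss [] ⟨h.2.1, by simp, by simp⟩
      rw [← ev_neg] at this
      simpa [neg, wd, Function.comp_def] using this
    | cons t ts =>
      obtain ⟨X1, X, r, Y, hp, he, hX, hY, hr⟩ := ln_to_rn H b hb ss h.2.1 ts t h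
      rw [he, hrn _ _ hr, hX]
      simp [hY]
  gen := hgen

theorem ev_wd (b : P → G) (xs ys : List P) :
    ev b (wd xs ys) = (xs.map fun x => b x).prod * (ys.map fun y => (b y)⁻¹).prod := by
  induction xs with
  | nil =>
    induction ys with
    | nil => simp [wd, ev]
    | cons y ys ih =>
      rw [wd_nil_cons]; simp only [ev]; rw [ih]; simp
  | cons x xs ih => rw [wd_cons]; simp only [ev]; rw [ih]; simp [mul_assoc]

end A2Aux

/-- if consecutive products in a sequence `w₀, w₁, …, w_n` are
`δ`-additive and the intermediate terms `w₁, …, w_{n-1}` have shape at least `(1,1)`,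
then `δ (w₀ ⋯ w_n) = δ w₀ + ⋯ + δ w_n`. -/
theorem a2_shape_additive_chain (P L : Type) [Fintype P] [Fintype L]
    [Membership P L] [Configuration.ProjectivePlane P L]
    (σ : P ≃ L) (T : Set (P × P × P))
    (hT1 : ∀ x y : P, (∃ z, (x, y, z) ∈ T) ↔ y ∈ σ x)
    (hT2 : ∀ x y z : P, (x, y, z) ∈ T → (y, z, x) ∈ T)
    (hT3 : ∀ x y z z' : P, (x, y, z) ∈ T → (x, y, z') ∈ T → z = z')
    (δ : A2TildeGroup T → ℕ × ℕ)
    (hδ : ∀ (w : A2TildeGroup T) (m n : ℕ),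
      δ w = (m, n) ↔ ∃ xs ys : List P, IsRNF σ T w xs ys ∧ xs.length = m ∧ ys.length = n)
    (n : ℕ) (hn : 1 ≤ n) (w : Fin (n + 1) → A2TildeGroup T)
    (hadd : ∀ i : Fin n, δ (w i.castSucc * w i.succ) = δ (w i.castSucc) + δ (w i.succ))
    (hmid : ∀ i : Fin (n + 1), 0 < (i : ℕ) → (i : ℕ) < n → (1, 1) ≤ δ (w i)) :
    δ (List.ofFn w).prod = ∑ i, δ (w i) := by
  have H : A2Aux.Tri T (fun x y => y ∈ σ x) := by
    refine ⟨hT1, hT2, hT3, ?_, ?_, ?_⟩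
    · intro x y h
      obtain ⟨l, hl⟩ : ∃ l : L, x ∈ l ∧ y ∈ l :=
        ⟨_, Configuration.HasLines.mkLine_ax h⟩
      exact ⟨σ.symm l, by simpa using hl⟩
    · intro x y h
      exact ⟨_, Configuration.HasPoints.mkPoint_ax (σ.injective.ne h)⟩
    · intro p q z z' hpq h1 h2 h3 h4
      exact (Configuration.Nondegenerate.eq_or_eq h1 h3 h2 h4).resolve_right (σ.injective.ne hpq)
  have hb : ∀ x y z, (x, y, z) ∈ T → a T x * a T y * a T z = 1 := by
    intro x y z h
    have : (PresentedGroup.mk (A2Rels T))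
        (FreeGroup.of x * FreeGroup.of y * FreeGroup.of z) = 1 :=
      PresentedGroup.one_of_mem ⟨(x, y, z), h, rfl⟩
    simpa [a, PresentedGroup.of] using this
  have S : A2Aux.Sys (a T) (fun x y => y ∈ σ x) δ := by
    refine A2Aux.mkSys H (a T) hb ?_ ?_
    · intro xs ys h
      rw [hδ]
      exact ⟨xs, ys, ⟨A2Aux.ev_wd _ _ _, h.1, h.2.1, h.2.2⟩, rfl, rfl⟩
    · intro g
      obtain ⟨xs, ys, h, -, -⟩ := (hδ g _ _).1 (rfl : δ g = ((δ g).1, (δ g).2))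
      exact ⟨A2Aux.wd xs ys, by rw [A2Aux.ev_wd]; exact h.1.symm⟩
  obtain ⟨k, rfl⟩ : ∃ k, n = k + 1 := ⟨n - 1, by omega⟩
  have := A2Aux.chain S k (w 0) (fun i => w i.succ) (by simpa using hadd 0)
    (fun i => by simpa using hadd i.succ)
    (fun i hi => hmid _ (by simp) (by simpa using hi))
  rw [List.ofFn_succ, List.prod_cons, this, Fin.sum_univ_succ (fun i => δ (w i))]
end
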